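/- Let $Q = (q_n)$ be a sequence of integers with $q_n \geq 2$, and for each $n$ let $I_n \subseteq \{0, 1, \ldots, q_n - 1\}$ be non-empty. Suppose $\lim_{n\to\infty} \frac{\log q_n}{\log(q_1 \cdots q_n)} = 0$. Then the Hausdorff dimension of the set $\mathscr{R}_{\mathscr{I}}(Q) = \{ \sum_{n=1}^{\infty} \frac{E_n}{q_1 \cdots q_n} : E_j \in I_j \text{ for all } j \}$ equals $\liminf_{n\to\infty} \frac{\log(|I_1| |I_2| \cdots |I_n|)}{\log(q_1 q_2 \cdots q_n)}$. -/

import Mathlib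

open Filter

namespace Cantor
open MeasureTheory

/-- partial products -/
def P (q : ℕ → ℕ) (n : ℕ) : ℝ := ∏ i ∈ Finset.range n, (q i : ℝ)

/-- integer value of the initial block of length n -/
def K (q E : ℕ → ℕ) : ℕ → ℕ
  | 0 => 0
  | n + 1 => K q E n * q n + E n

/-- the value of the series -/
noncomputable def val (q E : ℕ → ℕ) : ℝ :=
  ∑' n : ℕ, (E n : ℝ) / ∏ i ∈ Finset.range (n + 1), (q i : ℝ)

lemma P_succ (q : ℕ → ℕ) (n : ℕ) : P q (n + 1) = P q n * q n := by
  simp [P, Finset.prod_range_succ]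

lemma P_pos {q : ℕ → ℕ} (hq : ∀ n, 2 ≤ q n) (n : ℕ) : 0 < P q n := by
  apply Finset.prod_pos
  intro i _
  have := hq i
  exact_mod_cast (by omega : 0 < q i)

lemma P_ge {q : ℕ → ℕ} (hq : ∀ n, 2 ≤ q n) (n : ℕ) : (2 : ℝ) ^ n ≤ P q n := by
  induction n with
  | zero => simp [P]
  | succ n ih =>
    rw [P_succ, pow_succ]
    have : (2 : ℝ) ≤ q n := by exact_mod_cast hq n
    exact mul_le_mul ih this (by norm_num) (P_pos hq n).le

lemma P_mono {q : ℕ → ℕ} (hq : ∀ n, 2 ≤ q n) : Monotone (P q) := by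
  apply monotone_nat_of_le_succ
  intro n
  rw [P_succ]
  have : (2 : ℝ) ≤ q n := by exact_mod_cast hq n
  have := P_pos hq n
  nlinarith

lemma tendsto_P {q : ℕ → ℕ} (hq : ∀ n, 2 ≤ q n) : Tendsto (P q) atTop atTop :=
  tendsto_atTop_mono (P_ge hq) (tendsto_pow_atTop_atTop_of_one_lt (by norm_num))

lemma sum_eq {q : ℕ → ℕ} (hq : ∀ n, 2 ≤ q n) (E : ℕ → ℕ) (n : ℕ) :
    ∑ j ∈ Finset.range n, (E j : ℝ) / ∏ i ∈ Finset.range (j + 1), (q i : ℝ) = K q E n / P q n := by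
  induction n with
  | zero => simp [K]
  | succ n ih =>
    rw [Finset.sum_range_succ, ih]
    change _ + (E n : ℝ) / P q (n + 1) = _
    have h1 := (P_pos hq n).ne'
    have h2 : (q n : ℝ) ≠ 0 := by have := hq n; positivity
    rw [P_succ]
    simp only [K]
    push_cast
    field_simp

lemma lo_mono {q : ℕ → ℕ} (hq : ∀ n, 2 ≤ q n) (E : ℕ → ℕ) :
    Monotone (fun n => (K q E n : ℝ) / P q n) := by
  apply monotone_nat_of_le_succ
  intro n
  have h1 := P_pos hq n
  have h2 : (0 : ℝ) < q n := by have := hq n; positivity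
  rw [P_succ, div_le_div_iff₀ h1 (by positivity)]
  simp only [K]
  push_cast
  have : (0 : ℝ) ≤ E n * P q n := by positivity
  nlinarith

lemma hi_anti {q : ℕ → ℕ} (hq : ∀ n, 2 ≤ q n) {E : ℕ → ℕ} (hE : ∀ n, E n < q n) :
    Antitone (fun n => ((K q E n : ℝ) + 1) / P q n) := by
  apply antitone_nat_of_succ_le
  intro n
  have h1 := P_pos hq n
  have h2 : (0 : ℝ) < q n := by have := hq n; positivity
  have h3 : (E n : ℝ) + 1 ≤ q n := by exact_mod_cast hE n
  rw [P_succ, div_le_div_iff₀ (by positivity) h1]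
  simp only [K]
  push_cast
  have : ((E n : ℝ) + 1) * P q n ≤ q n * P q n := by gcongr
  nlinarith

lemma lo_le_hi {q : ℕ → ℕ} (hq : ∀ n, 2 ≤ q n) {E : ℕ → ℕ} (hE : ∀ n, E n < q n) (m n : ℕ) :
    (K q E m : ℝ) / P q m ≤ ((K q E n : ℝ) + 1) / P q n := by
  refine (lo_mono hq E (le_max_left m n)).trans (le_trans ?_ (hi_anti hq hE (le_max_right m n)))
  have := P_pos hq (max m n)
  simp only
  gcongr
  linarith

lemma tendsto_val {q : ℕ → ℕ} (hq : ∀ n, 2 ≤ q n) {E : ℕ → ℕ} (hE : ∀ n, E n < q n) :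
    Tendsto (fun n => (K q E n : ℝ) / P q n) atTop (nhds (val q E)) := by
  have hs : Summable (fun n : ℕ => (E n : ℝ) / ∏ i ∈ Finset.range (n + 1), (q i : ℝ)) := by
    apply summable_of_sum_range_le (c := ((K q E 0 : ℝ) + 1) / P q 0)
    · intro n; positivity
    · intro n
      rw [sum_eq hq]
      exact lo_le_hi hq hE n 0
  have := hs.hasSum.tendsto_sum_nat
  simp only [sum_eq hq] at this
  exact this

lemma le_val {q : ℕ → ℕ} (hq : ∀ n, 2 ≤ q n) {E : ℕ → ℕ} (hE : ∀ n, E n < q n) (n : ℕ) :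
    (K q E n : ℝ) / P q n ≤ val q E :=
  (lo_mono hq E).ge_of_tendsto (tendsto_val hq hE) n

lemma val_le {q : ℕ → ℕ} (hq : ∀ n, 2 ≤ q n) {E : ℕ → ℕ} (hE : ∀ n, E n < q n) (n : ℕ) :
    val q E ≤ ((K q E n : ℝ) + 1) / P q n :=
  le_of_tendsto' (tendsto_val hq hE) (fun m => lo_le_hi hq hE m n)

lemma K_congr (q : ℕ → ℕ) {E F : ℕ → ℕ} (n : ℕ) (h : ∀ i < n, E i = F i) : K q E n = K q F n := by
  induction n with
  | zero => rfl
  | succ n ih =>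
    simp only [K]
    rw [ih (fun i hi => h i (by omega)), h n (by omega)]

lemma K_inj {q : ℕ → ℕ} {E F : ℕ → ℕ} (hE : ∀ n, E n < q n) (hF : ∀ n, F n < q n) (n : ℕ)
    (h : K q E n = K q F n) : ∀ i < n, E i = F i := by
  induction n with
  | zero => intro i hi; omega
  | succ n ih =>
    simp only [K] at h
    have h1 : E n = F n := by
      have := congrArg (· % q n) h
      simpa [Nat.mod_eq_of_lt (hE n), Nat.mod_eq_of_lt (hF n), Nat.add_mod] using this
    rw [h1] at h
    have h0 : 0 < q n := by have := hE n; omega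
    have h2 : K q E n = K q F n := Nat.eq_of_mul_eq_mul_right h0 (by omega)
    intro i hi
    rcases Nat.lt_succ_iff_lt_or_eq.mp hi with h' | rfl
    · exact ih h2 i h'
    · exact h1

lemma val_close {q : ℕ → ℕ} (hq : ∀ n, 2 ≤ q n) {E F : ℕ → ℕ} (hE : ∀ n, E n < q n)
    (hF : ∀ n, F n < q n) (n : ℕ) (h : ∀ i < n, E i = F i) :
    edist (val q E) (val q F) ≤ ENNReal.ofReal (1 / P q n) := by
  have h1 := le_val hq hE n
  have h2 := le_val hq hF n
  have h3 := val_le hq hE n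
  have h4 := val_le hq hF n
  rw [K_congr q n h] at h1 h3
  rw [edist_dist]
  apply ENNReal.ofReal_le_ofReal
  rw [Real.dist_eq, abs_le]
  rw [add_div] at h3 h4
  constructor <;> linarith

section meas
variable {q : ℕ → ℕ} {I : ℕ → Finset ℕ}

lemma upper (hq : ∀ n, 2 ≤ q n) (hsub : ∀ n, ∀ e ∈ I n, e < q n) (d : NNReal)
    (h : ∃ᶠ n in atTop, (∏ i ∈ Finset.range (n + 1), ((I i).card : ℝ)) ≤ P q (n + 1) ^ (d : ℝ)) :
    dimH (Set.range fun w : (n : ℕ) → I n => val q (fun n => w n)) ≤ d := by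
  apply dimH_le_of_hausdorffMeasure_ne_top
  apply ne_of_lt
  refine lt_of_le_of_lt ?_ ENNReal.one_lt_top
  let t : (n : ℕ) → ((i : Fin (n + 1)) → I i) → Set ℝ := fun n p =>
    (fun w : (n : ℕ) → I n => val q (fun n => w n)) '' {w | ∀ i : Fin (n + 1), w i = p i}
  have hdiam : ∀ n p, Metric.ediam (t n p) ≤ ENNReal.ofReal (1 / P q (n + 1)) := by
    intro n p
    apply Metric.ediam_le
    rintro _ ⟨w, hw, rfl⟩ _ ⟨v, hv, rfl⟩
    refine val_close hq (fun n => hsub n _ (w n).2) (fun n => hsub n _ (v n).2) (n + 1) ?_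
    intro i hi
    have h1 := hw ⟨i, hi⟩
    have h2 := hv ⟨i, hi⟩
    simp only at h1 h2
    rw [h1, h2]
  have hcard : ∀ n, (Finset.univ : Finset ((i : Fin (n + 1)) → I i)).card =
      ∏ i ∈ Finset.range (n + 1), (I i).card := by
    intro n
    rw [Finset.card_univ, Fintype.card_pi, ← Fin.prod_univ_eq_prod_range (fun i => (I i).card)]
    exact Finset.prod_congr rfl (fun i _ => Fintype.card_coe _)
  refine (Measure.hausdorffMeasure_le_liminf_sum (d : ℝ) _ (l := atTop)
    (fun n => ENNReal.ofReal (1 / P q (n + 1))) ?_ t (Eventually.of_forall hdiam)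
    (Eventually.of_forall ?_)).trans ?_
  · rw [← ENNReal.ofReal_zero]
    apply (ENNReal.continuous_ofReal.tendsto 0).comp
    have := ((tendsto_P hq).comp (tendsto_add_atTop_nat 1)).inv_tendsto_atTop
    simp only [one_div]
    exact this
  · rintro n _ ⟨w, rfl⟩
    exact Set.mem_iUnion.2 ⟨fun i => w i, w, fun i => rfl, rfl⟩
  · refine liminf_le_of_frequently_le ?_ (by isBoundedDefault)
    refine h.mono ?_
    intro n hn
    have hP := P_pos hq (n + 1)
    have hM0 : 0 ≤ ∏ i ∈ Finset.range (n + 1), ((I i).card : ℝ) :=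
      Finset.prod_nonneg (fun i _ => Nat.cast_nonneg _)
    calc ∑ p, Metric.ediam (t n p) ^ (d : ℝ)
        ≤ ∑ p : (i : Fin (n + 1)) → I i, ENNReal.ofReal (1 / P q (n + 1)) ^ (d : ℝ) := by
          apply Finset.sum_le_sum
          intro p _
          exact ENNReal.rpow_le_rpow (hdiam n p) d.2
      _ = ENNReal.ofReal ((∏ i ∈ Finset.range (n + 1), ((I i).card : ℝ)) *
            (1 / P q (n + 1)) ^ (d : ℝ)) := by
          rw [Finset.sum_const, nsmul_eq_mul, ENNReal.ofReal_mul hM0,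
            ENNReal.ofReal_rpow_of_pos (by positivity)]
          rw [hcard n, ← Nat.cast_prod, ENNReal.ofReal_natCast]
      _ ≤ 1 := by
          rw [ENNReal.ofReal_le_one, Real.div_rpow zero_le_one hP.le, Real.one_rpow, mul_one_div]
          exact div_le_one_of_le₀ hn (Real.rpow_nonneg hP.le _)

/-- product of uniform measures -/
noncomputable def mu (I : ℕ → Finset ℕ) : Measure ((n : ℕ) → I n) :=
  Measure.infinitePi (fun n => ProbabilityTheory.uniformOn (Set.univ : Set (I n)))

lemma prob1 (hne : ∀ n, (I n).Nonempty) (n : ℕ) :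
    IsProbabilityMeasure (ProbabilityTheory.uniformOn (Set.univ : Set (I n))) := by
  have := (hne n).to_subtype
  exact ProbabilityTheory.isProbabilityMeasure_uniformOn Set.finite_univ Set.univ_nonempty

lemma mu_cyl (hne : ∀ n, (I n).Nonempty) (hsub : ∀ n, ∀ e ∈ I n, e < q n) (n k : ℕ) :
    mu I {w | K q (fun i => w i) n = k} ≤
      ENNReal.ofReal (1 / ∏ i ∈ Finset.range n, ((I i).card : ℝ)) := by
  have := prob1 hne
  rcases Set.eq_empty_or_nonempty {w : (n : ℕ) → I n | K q (fun i => w i) n = k} with h | ⟨v, hv⟩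
  · rw [h]; simp
  · have hs : {w : (n : ℕ) → I n | K q (fun i => w i) n = k} ⊆
        ((Finset.range n : Finset ℕ) : Set ℕ).pi (fun i => {v i}) := by
      intro w hw i hi
      apply Subtype.ext
      refine K_inj (fun n => hsub n _ (w n).2) (fun n => hsub n _ (v n).2) n (hw.trans hv.symm) i ?_
      simpa using hi
    refine (measure_mono hs).trans ?_
    rw [mu, Measure.infinitePi_pi _ (fun i _ => measurableSet_singleton _), one_div,
      ← Finset.prod_inv_distrib, ENNReal.ofReal_prod_of_nonneg (fun i _ => by positivity)]
    apply Finset.prod_le_prod'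
    intro i _
    rw [ProbabilityTheory.uniformOn_univ, Measure.count_singleton, Fintype.card_coe,
      ENNReal.ofReal_inv_of_pos (by exact_mod_cast (hne i).card_pos), ENNReal.ofReal_natCast,
      one_div]

lemma mu_small (hq : ∀ n, 2 ≤ q n) (hne : ∀ n, (I n).Nonempty)
    (hsub : ∀ n, ∀ e ∈ I n, e < q n) (n : ℕ) (s : Set ℝ)
    (hs : Metric.ediam s < ENNReal.ofReal (1 / P q n)) :
    mu I ((fun w : (n : ℕ) → I n => val q (fun n => w n)) ⁻¹' s) ≤
      ENNReal.ofReal (3 / ∏ i ∈ Finset.range n, ((I i).card : ℝ)) := by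
  rcases Set.eq_empty_or_nonempty
    ((fun w : (n : ℕ) → I n => val q (fun n => w n)) ⁻¹' s) with h | ⟨v, hv⟩
  · rw [h]; simp
  have hP := P_pos hq n
  set k := K q (fun i => v i) n with hk
  have key : ∀ a b : (n : ℕ) → I n, val q (fun n => a n) ∈ s → val q (fun n => b n) ∈ s →
      K q (fun i => a i) n ≤ K q (fun i => b i) n + 1 := by
    intro a b ha hb
    have h1 := le_val hq (fun n => hsub n _ (a n).2) n
    have h2 := val_le hq (fun n => hsub n _ (b n).2) n
    have h3 := (Metric.edist_le_ediam_of_mem ha hb).trans_lt hs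
    rw [edist_dist, ENNReal.ofReal_lt_ofReal_iff (by positivity), Real.dist_eq] at h3
    have h4 := (le_abs_self _).trans_lt h3
    have h5 : (K q (fun i => a i) n : ℝ) / P q n < (K q (fun i => b i) n + 1 + 1) / P q n := by
      rw [add_div _ 1]
      linarith
    rw [div_lt_div_iff_of_pos_right hP] at h5
    have : K q (fun i => a i) n < K q (fun i => b i) n + 1 + 1 := by exact_mod_cast h5
    omega
  have hcov : (fun w : (n : ℕ) → I n => val q (fun n => w n)) ⁻¹' s ⊆
      ⋃ j ∈ Finset.Icc (k - 1) (k + 1), {w : (n : ℕ) → I n | K q (fun i => w i) n = j} := by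
    intro w hw
    have h1 := key w v hw hv
    have h2 := key v w hv hw
    simp only [Set.mem_iUnion, Set.mem_ofPred_eq, Finset.mem_Icc]
    exact ⟨_, by omega, rfl⟩
  refine (measure_mono hcov).trans ((measure_biUnion_finset_le _ _).trans ?_)
  refine (Finset.sum_le_card_nsmul _ _ _ (fun j _ => mu_cyl hne hsub n j)).trans ?_
  rw [nsmul_eq_mul, ← ENNReal.ofReal_natCast, ← ENNReal.ofReal_mul (by positivity), mul_one_div]
  apply ENNReal.ofReal_le_ofReal
  have hM : 0 ≤ ∏ i ∈ Finset.range n, ((I i).card : ℝ) :=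
    Finset.prod_nonneg (fun i _ => Nat.cast_nonneg _)
  refine div_le_div_of_nonneg_right ?_ hM
  have : (Finset.Icc (k - 1) (k + 1)).card ≤ 3 := by rw [Nat.card_Icc]; omega
  exact_mod_cast this

lemma measurable_val (hq : ∀ n, 2 ≤ q n) (hsub : ∀ n, ∀ e ∈ I n, e < q n) :
    Measurable (fun w : (n : ℕ) → I n => val q (fun n => w n)) := by
  apply measurable_of_tendsto_metrizable
    (f := fun n (w : (n : ℕ) → I n) => (K q (fun i => w i) n : ℝ) / P q n)
  · intro n
    have : Measurable (fun w : (n : ℕ) → I n => K q (fun i => w i) n) := by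
      induction n with
      | zero => exact measurable_const
      | succ n ih =>
        simp only [K]
        have h : Measurable (fun w : (n : ℕ) → I n => (w n : ℕ)) :=
          measurable_subtype_coe.comp (measurable_pi_apply n)
        exact (ih.mul_const _).add h
    exact (measurable_from_nat.comp this).div_const _
  · rw [tendsto_pi_nhds]
    intro w
    exact tendsto_val hq (fun n => hsub n _ (w n).2)

lemma lower (hq : ∀ n, 2 ≤ q n) (hne : ∀ n, (I n).Nonempty)
    (hsub : ∀ n, ∀ e ∈ I n, e < q n) (d : NNReal) (_hd : 0 < d)
    (h : ∀ᶠ n in atTop, 3 * P q (n + 1) ^ (d : ℝ) ≤ ∏ i ∈ Finset.range n, ((I i).card : ℝ)) :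
    d ≤ dimH (Set.range fun w : (n : ℕ) → I n => val q (fun n => w n)) := by
  have := prob1 hne
  have hmeas := measurable_val hq hsub
  apply le_dimH_of_hausdorffMeasure_ne_zero
  obtain ⟨N, hN⟩ := eventually_atTop.1 h
  have hbd : ∀ n ≥ N, ENNReal.ofReal (3 / ∏ i ∈ Finset.range n, ((I i).card : ℝ)) ≤
      ENNReal.ofReal (1 / P q (n + 1)) ^ (d : ℝ) := by
    intro n hn
    have hP := P_pos hq (n + 1)
    have hM : 0 < ∏ i ∈ Finset.range n, ((I i).card : ℝ) :=
      Finset.prod_pos (fun i _ => by exact_mod_cast (hne i).card_pos)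
    rw [ENNReal.ofReal_rpow_of_pos (by positivity)]
    apply ENNReal.ofReal_le_ofReal
    rw [Real.div_rpow zero_le_one hP.le, Real.one_rpow, div_le_div_iff₀ hM (by positivity), one_mul]
    exact hN n hn
  have hinv : Tendsto (fun n => ENNReal.ofReal (1 / P q (n + 1))) atTop (nhds 0) := by
    rw [← ENNReal.ofReal_zero]
    apply (ENNReal.continuous_ofReal.tendsto 0).comp
    have := ((tendsto_P hq).comp (tendsto_add_atTop_nat 1)).inv_tendsto_atTop
    simp only [one_div]
    exact this
  have hle : Measure.map (fun w : (n : ℕ) → I n => val q (fun n => w n)) (mu I) ≤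
      Measure.hausdorffMeasure (d : ℝ) := by
    apply Measure.le_hausdorffMeasure (d : ℝ) _ (ENNReal.ofReal (1 / P q (N + 1)))
    · have := P_pos hq (N + 1)
      simpa using this
    intro s hs
    refine (measure_mono subset_closure).trans ?_
    rw [Measure.map_apply hmeas isClosed_closure.measurableSet]
    rw [← Metric.ediam_closure s] at hs ⊢
    set δ := Metric.ediam (closure s) with hδ
    by_cases h0 : δ = 0
    · have h1 : ∀ᶠ n in atTop, mu I ((fun w : (n : ℕ) → I n => val q (fun n => w n)) ⁻¹' closure s) ≤
          ENNReal.ofReal (1 / P q (n + 1)) ^ (d : ℝ) := by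
        filter_upwards [eventually_ge_atTop N] with n hn
        refine (mu_small hq hne hsub n _ ?_).trans (hbd n hn)
        rw [← hδ, h0]
        have := P_pos hq n
        simpa using this
      rw [h0]
      exact ge_of_tendsto ((ENNReal.continuous_rpow_const.tendsto 0).comp hinv) h1
    · have hex : ∃ n, ENNReal.ofReal (1 / P q (n + 1)) ≤ δ :=
        ((hinv.eventually_lt_const (pos_iff_ne_zero.2 h0)).exists).imp (fun _ h => h.le)
      classical
      let n := Nat.find hex
      have hn : ENNReal.ofReal (1 / P q (n + 1)) ≤ δ := Nat.find_spec hex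
      have hnN : N ≤ n := by
        have h2 := hn.trans hs
        by_contra hlt
        have h3 : P q (n + 1) < P q (N + 1) := by
          have h4 : P q (n + 1) ≤ P q N := P_mono hq (by omega)
          have h5 := P_pos hq N
          have h6 : (2 : ℝ) ≤ q N := by exact_mod_cast hq N
          rw [P_succ q N]
          nlinarith
        rw [ENNReal.ofReal_le_ofReal_iff (by have := P_pos hq (N + 1); positivity)] at h2
        rw [one_div_le_one_div (P_pos hq _) (P_pos hq _)] at h2
        linarith
      have hlt : δ < ENNReal.ofReal (1 / P q n) := by
        rcases Nat.eq_zero_or_pos n with h0 | hpos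
        · refine hs.trans_lt ?_
          rw [h0, ENNReal.ofReal_lt_ofReal_iff (by simp [P])]
          have h5 := P_pos hq N
          have h7 : P q 0 ≤ P q N := P_mono hq (by omega)
          have h6 : (2 : ℝ) ≤ q N := by exact_mod_cast hq N
          apply one_div_lt_one_div_of_lt (P_pos hq 0)
          rw [P_succ q N]
          nlinarith
        · have := Nat.find_min hex (m := n - 1) (Nat.sub_lt hpos one_pos)
          rw [show n - 1 + 1 = n by omega] at this
          exact not_le.1 this
      refine (mu_small hq hne hsub n _ hlt).trans ((hbd n hnN).trans ?_)
      exact ENNReal.rpow_le_rpow hn d.2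
  have hprob : IsProbabilityMeasure (mu I) := by unfold mu; infer_instance
  have h1 := (Measure.le_map_apply (μ := mu I) hmeas.aemeasurable
    (Set.range fun w : (n : ℕ) → I n => val q (fun n => w n))).trans (hle _)
  rw [Set.preimage_range, measure_univ] at h1
  exact (lt_of_lt_of_le one_pos h1).ne'

end meas
end Cantor

theorem stmt19 (q : ℕ → ℕ) (hq : ∀ n, 2 ≤ q n)
    (I : ℕ → Finset ℕ) (hne : ∀ n, (I n).Nonempty) (hsub : ∀ n, ∀ e ∈ I n, e < q n)
    (hlog : Tendsto
      (fun n => Real.log (q n) / Real.log (∏ i ∈ Finset.range (n + 1), (q i : ℝ)))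
      atTop (nhds 0)) :
    dimH {x : ℝ | ∃ E : ℕ → ℕ, (∀ n, E n ∈ I n) ∧
        x = ∑' n : ℕ, (E n : ℝ) / ∏ i ∈ Finset.range (n + 1), (q i : ℝ)} =
      ENNReal.ofReal (Filter.liminf (fun n =>
        Real.log (∏ i ∈ Finset.range (n + 1), ((I i).card : ℝ)) /
          Real.log (∏ i ∈ Finset.range (n + 1), (q i : ℝ))) atTop) := by
  have hset : {x : ℝ | ∃ E : ℕ → ℕ, (∀ n, E n ∈ I n) ∧
        x = ∑' n : ℕ, (E n : ℝ) / ∏ i ∈ Finset.range (n + 1), (q i : ℝ)} =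
      Set.range fun w : (n : ℕ) → I n => Cantor.val q (fun n => w n) := by
    ext x
    constructor
    · rintro ⟨E, hE, rfl⟩
      exact ⟨fun n => ⟨E n, hE n⟩, rfl⟩
    · rintro ⟨w, rfl⟩
      exact ⟨fun n => w n, fun n => (w n).2, rfl⟩
  rw [hset]
  have hPdef : ∀ n, ∏ i ∈ Finset.range n, (q i : ℝ) = Cantor.P q n := fun _ => rfl
  simp only [hPdef] at hlog ⊢
  set M : ℕ → ℝ := fun n => ∏ i ∈ Finset.range n, ((I i).card : ℝ) with hM
  have hMdef : ∀ n, ∏ i ∈ Finset.range n, ((I i).card : ℝ) = M n := fun _ => rfl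
  simp only [hMdef]
  have hc1 : ∀ i, (1 : ℝ) ≤ (I i).card := fun i => by exact_mod_cast (hne i).card_pos
  have hM1 : ∀ n, 1 ≤ M n := fun n => by
    induction n with
    | zero => simp [hM]
    | succ n ih =>
      have : M (n + 1) = M n * (I n).card := Finset.prod_range_succ _ _
      rw [this]
      exact one_le_mul_of_one_le_of_one_le ih (hc1 n)
  have hMP : ∀ n, M n ≤ Cantor.P q n := by
    intro n
    apply Finset.prod_le_prod (fun i _ => Nat.cast_nonneg _)
    intro i _
    have : (I i).card ≤ (Finset.range (q i)).card :=
      Finset.card_le_card (fun e he => Finset.mem_range.2 (hsub i e he))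
    rw [Finset.card_range] at this
    exact_mod_cast this
  have hPpos := Cantor.P_pos hq
  have hP2 : ∀ n, 1 < Cantor.P q (n + 1) := fun n =>
    lt_of_lt_of_le (one_lt_pow₀ (by norm_num) (by omega)) (Cantor.P_ge hq (n + 1))
  have hlP : ∀ n, 0 < Real.log (Cantor.P q (n + 1)) := fun n => Real.log_pos (hP2 n)
  set a : ℕ → ℝ := fun n => Real.log (M (n + 1)) / Real.log (Cantor.P q (n + 1)) with ha
  have ha0 : ∀ n, 0 ≤ a n := fun n => div_nonneg (Real.log_nonneg (hM1 _)) (hlP n).le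
  have ha1 : ∀ n, a n ≤ 1 := fun n => by
    apply div_le_one_of_le₀ _ (hlP n).le
    exact Real.log_le_log (by linarith [hM1 (n + 1)]) (hMP _)
  have hb1 : IsBoundedUnder (· ≥ ·) atTop a := isBoundedUnder_of ⟨0, ha0⟩
  have hb2 : IsCoboundedUnder (· ≥ ·) atTop a :=
    IsBoundedUnder.isCoboundedUnder_ge (isBoundedUnder_of ⟨1, ha1⟩)
  apply le_antisymm
  · apply le_of_forall_gt_imp_ge_of_dense
    intro d hd
    by_cases hdt : d = ⊤
    · rw [hdt]; exact le_top
    lift d to NNReal using hdt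
    apply Cantor.upper hq hsub
    have hd' : liminf a atTop < d := by
      by_contra hcon
      refine hd.not_ge ?_
      rw [← ENNReal.ofReal_coe_nnreal]
      exact ENNReal.ofReal_le_ofReal (not_lt.1 hcon)
    refine (frequently_lt_of_liminf_lt hb2 hd').mono ?_
    intro n hn
    rw [ha] at hn
    simp only at hn
    rw [div_lt_iff₀ (hlP n)] at hn
    change M (n + 1) ≤ _
    rw [← Real.log_le_log_iff (by linarith [hM1 (n + 1)]) (by have := hPpos (n + 1); positivity),
      Real.log_rpow (hPpos _)]
    exact hn.le
  · apply ENNReal.le_of_forall_pos_nnreal_lt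
    intro d hd hdL
    have hdL' : (d : ℝ) < liminf a atTop := by
      rw [ENNReal.coe_lt_ofReal] at hdL
      exact hdL
    apply Cantor.lower hq hne hsub d hd
    have hd0 : (0 : ℝ) < d := hd
    obtain ⟨d', h1, h2⟩ := exists_between hdL'
    have hd'0 : 0 < d' := hd0.trans h1
    have e1 := eventually_lt_of_lt_liminf h2 hb1
    have e1' : ∀ᶠ n in atTop, d' * Real.log (Cantor.P q n) ≤ Real.log (M n) := by
      obtain ⟨N, hN⟩ := eventually_atTop.1 e1
      filter_upwards [eventually_ge_atTop (N + 1)] with n hn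
      obtain ⟨m, rfl⟩ : ∃ m, n = m + 1 := ⟨n - 1, by omega⟩
      have := hN m (by omega)
      rw [ha] at this
      simp only at this
      rw [lt_div_iff₀ (hlP m)] at this
      exact this.le
    have hη : 0 < (d' - d) / (2 * d') := div_pos (by linarith) (by linarith)
    have e2 := hlog.eventually_lt_const hη
    have e3 : ∀ᶠ n in atTop, Real.log 3 / ((d' - d) / 2) ≤ Real.log (Cantor.P q (n + 1)) :=
      (Real.tendsto_log_atTop.comp
        ((Cantor.tendsto_P hq).comp (tendsto_add_atTop_nat 1))).eventually_ge_atTop _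
    filter_upwards [e1', e2, e3] with n h3 h4 h5
    change _ ≤ M n
    have hP := hPpos (n + 1)
    rw [← Real.log_le_log_iff (by positivity) (by linarith [hM1 n]),
      Real.log_mul (by norm_num) (by positivity), Real.log_rpow hP]
    rw [div_lt_iff₀ (hlP n)] at h4
    rw [div_le_iff₀ (by linarith)] at h5
    have hqn : (q n : ℝ) ≠ 0 := by have := hq n; positivity
    have h6 : Real.log (Cantor.P q (n + 1)) = Real.log (Cantor.P q n) + Real.log (q n) := by
      rw [Cantor.P_succ, Real.log_mul (hPpos n).ne' hqn]
    have h7 : d' * Real.log (q n) ≤ (d' - d) / 2 * Real.log (Cantor.P q (n + 1)) := by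
      calc d' * Real.log (q n) ≤ d' * ((d' - d) / (2 * d') * Real.log (Cantor.P q (n + 1))) := by
            gcongr
        _ = _ := by field_simp
    have h8 : d' * Real.log (Cantor.P q (n + 1)) =
        d' * Real.log (Cantor.P q n) + d' * Real.log (q n) := by rw [h6]; ring
    nlinarith
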